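/- (Steffens–Theobald) Let P_1, …, P_k be lattice polytopes in ℝ^d such that P_1 + ⋯ + P_k is d-dimensional. Then the leading coefficient me_d of the mixed Ehrhart polynomial ME_{P_1,…,P_k}(n) equals Σ_α v_α, where the sum runs over all α ∈ ℤ_{≥1}^k with α_1 + ⋯ + α_k = d and v_α are the coefficients of the volume polynomial V of (P_1,…,P_k). -/

import Mathlib

open Pointwise MeasureTheory Filter
open scoped Classical

/-- A lattice polytope in `ℝ^d`: the convex hull of finitely many integer points. -/
def IsLatticePolytope {d : ℕ} (P : Set (Fin d → ℝ)) : Prop :=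
  ∃ V : Finset (Fin d → ℤ), V.Nonempty ∧
    P = convexHull ℝ ((fun z : Fin d → ℤ => fun i => (z i : ℝ)) '' ↑V)

/-- The number of lattice points of a subset of `ℝ^d`. -/
noncomputable def latticePointCount {d : ℕ} (P : Set (Fin d → ℝ)) : ℕ :=
  Set.ncard {z : Fin d → ℤ | (fun i => (z i : ℝ)) ∈ P}

/-- The discrete mixed volume `DMV(P_1, …, P_k)`; here `∑ j ∈ J, P j` is a Minkowski
sum of sets, with the empty sum being `{0}`. -/
noncomputable def DMV {d k : ℕ} (P : Fin k → Set (Fin d → ℝ)) : ℤ :=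
  ∑ J : Finset (Fin k), (-1) ^ (k - J.card) * (latticePointCount (∑ j ∈ J, P j) : ℤ)

/-- The dimension of a polytope: the dimension of its affine hull. -/
noncomputable def polytopeDim {d : ℕ} (P : Set (Fin d → ℝ)) : ℕ :=
  Module.finrank ℝ (affineSpan ℝ P).direction

theorem IsLatticePolytope.convex {d : ℕ} {P : Set (Fin d → ℝ)} (h : IsLatticePolytope P) :
    Convex ℝ P := by
  obtain ⟨V, -, rfl⟩ := h
  exact convex_convexHull ℝ _

theorem IsLatticePolytope.isCompact {d : ℕ} {P : Set (Fin d → ℝ)} (h : IsLatticePolytope P) :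
    IsCompact P := by
  obtain ⟨V, -, rfl⟩ := h
  exact (V.finite_toSet.image _).isCompact_convexHull ℝ

theorem IsLatticePolytope.nonempty {d : ℕ} {P : Set (Fin d → ℝ)} (h : IsLatticePolytope P) :
    P.Nonempty := by
  obtain ⟨V, hV, rfl⟩ := h
  exact (hV.to_set.image _).convexHull

theorem isCompact_finset_sum {ι E : Type*} [AddCommMonoid E] [TopologicalSpace E] [ContinuousAdd E]
    (s : Finset ι) {P : ι → Set E} (h : ∀ i ∈ s, IsCompact (P i)) :
    IsCompact (∑ i ∈ s, P i) := by
  induction s using Finset.induction_on with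
  | empty =>
    rw [Finset.sum_empty]
    exact isCompact_singleton
  | insert a s ha ih =>
    rw [Finset.sum_insert ha]
    exact (h a (Finset.mem_insert_self a s)).add
      (ih fun i hi => h i (Finset.mem_insert_of_mem hi))

theorem latticePointCount_smul {d : ℕ} (K : Set (Fin d → ℝ)) {c : ℝ} (hc : c ≠ 0) :
    latticePointCount (c • K) = Nat.card
      ↑(K ∩ c⁻¹ • (Submodule.span ℤ (Set.range (Pi.basisFun ℝ (Fin d))) : Set (Fin d → ℝ))) := by
  let f : (Fin d → ℤ) → Fin d → ℝ := fun z => c⁻¹ • fun i => (z i : ℝ)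
  have hf : Function.Injective f := by
    intro z w h
    have h' := smul_right_injective (Fin d → ℝ) (inv_ne_zero hc) h
    funext i
    exact_mod_cast congrFun h' i
  rw [Nat.card_coe_set_eq, latticePointCount, ← Set.ncard_image_of_injective _ hf]
  congr 1
  ext x
  have hspan : ∀ y : Fin d → ℝ, y ∈ Submodule.span ℤ (Set.range (Pi.basisFun ℝ (Fin d))) ↔
      ∃ z : Fin d → ℤ, (fun i => (z i : ℝ)) = y := by
    intro y
    rw [Module.Basis.mem_span_iff_repr_mem]
    constructor
    · intro h
      choose z hz using h
      exact ⟨z, funext fun i => by simpa using hz i⟩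
    · rintro ⟨z, rfl⟩ i
      exact ⟨z i, by simp⟩
  constructor
  · rintro ⟨z, hz, rfl⟩
    exact ⟨(Set.mem_smul_set_iff_inv_smul_mem₀ hc _ _).1 hz,
      Set.smul_mem_smul_set ((hspan _).2 ⟨z, rfl⟩)⟩
  · rintro ⟨hx, y, hy, rfl⟩
    obtain ⟨z, rfl⟩ := (hspan _).1 hy
    exact ⟨z, (Set.mem_smul_set_iff_inv_smul_mem₀ hc _ _).2 hx, rfl⟩

theorem tendsto_latticePointCount_smul_div_pow {d : ℕ} {K : Set (Fin d → ℝ)}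
    (hconv : Convex ℝ K) (hK : IsCompact K) :
    Tendsto (fun n : ℕ => (latticePointCount ((n : ℝ) • K) : ℝ) / (n : ℝ) ^ d) atTop
      (nhds (volume K).toReal) := by
  have h := tendsto_card_div_pow_atTop_volume K hK.isBounded hK.measurableSet
    (hconv.addHaar_frontier volume)
  rw [Fintype.card_fin] at h
  refine h.congr' ?_
  filter_upwards [eventually_ne_atTop 0] with n hn
  rw [latticePointCount_smul K (Nat.cast_ne_zero.2 hn)]

theorem Polynomial.tendsto_eval_natCast_div_pow (M : Polynomial ℝ) {d : ℕ}
    (hM : M.natDegree ≤ d) :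
    Tendsto (fun n : ℕ => M.eval (n : ℝ) / (n : ℝ) ^ d) atTop (nhds (M.coeff d)) := by
  have h : Tendsto (fun x : ℝ => M.eval x / x ^ d) atTop (nhds (M.coeff d)) := by
    rcases hM.lt_or_eq with hlt | heq
    · rw [Polynomial.coeff_eq_zero_of_natDegree_lt hlt]
      have hdeg : M.degree < (Polynomial.X ^ d : Polynomial ℝ).degree := by
        rw [Polynomial.degree_X_pow]
        exact lt_of_le_of_lt Polynomial.degree_le_natDegree (by exact_mod_cast hlt)
      simpa using Polynomial.div_tendsto_atTop_zero_of_degree_lt M (Polynomial.X ^ d) hdeg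
    · subst heq
      by_cases h0 : M = 0
      · simp [h0]
      have hdeg : M.degree = (Polynomial.X ^ M.natDegree : Polynomial ℝ).degree := by
        rw [Polynomial.degree_X_pow, Polynomial.degree_eq_natDegree h0]
      simpa using Polynomial.div_tendsto_atTop_leadingCoeff_div_of_degree_eq M
        (Polynomial.X ^ M.natDegree) hdeg
  exact h.comp tendsto_natCast_atTop_atTop

theorem sum_neg_one_pow_mul_prod_indicator_pow {k : ℕ} (α : Fin k → ℕ) :
    ∑ J : Finset (Fin k), (-1 : ℝ) ^ (k - J.card) * ∏ i, (if i ∈ J then (1 : ℝ) else 0) ^ α i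
      = if ∀ j, 1 ≤ α j then 1 else 0 := by
  have h := Finset.prod_add (fun _ => (1 : ℝ)) (fun i => -(0 : ℝ) ^ α i)
    (Finset.univ : Finset (Fin k))
  rw [Finset.powerset_univ] at h
  have hterm : ∀ J : Finset (Fin k),
      (-1 : ℝ) ^ (k - J.card) * ∏ i, (if i ∈ J then (1 : ℝ) else 0) ^ α i
        = (∏ i ∈ J, (1 : ℝ)) * ∏ i ∈ Finset.univ \ J, -(0 : ℝ) ^ α i := by
    intro J
    rw [Finset.prod_const_one, one_mul, Finset.prod_neg,
      Finset.card_sdiff_of_subset (Finset.subset_univ J), Finset.card_univ, Fintype.card_fin,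
      ← Finset.prod_sdiff (Finset.subset_univ J)]
    congr 1
    rw [Finset.prod_eq_one (s := J) fun i hi => by simp [hi], mul_one]
    refine Finset.prod_congr rfl fun i hi => ?_
    rw [if_neg (Finset.mem_sdiff.1 hi).2]
  rw [Finset.sum_congr rfl fun J _ => hterm J, ← h]
  split_ifs with hα
  · exact Finset.prod_eq_one fun i _ => by simp [Nat.one_le_iff_ne_zero.1 (hα i)]
  · push Not at hα
    obtain ⟨j, hj⟩ := hα
    exact Finset.prod_eq_zero (Finset.mem_univ j) (by simp [Nat.lt_one_iff.1 hj])

theorem MvPolynomial.sum_neg_one_pow_mul_eval_indicator {k : ℕ} (V : MvPolynomial (Fin k) ℝ) :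
    ∑ J : Finset (Fin k),
        (-1 : ℝ) ^ (k - J.card) * MvPolynomial.eval (fun i => if i ∈ J then (1 : ℝ) else 0) V
      = ∑ α ∈ V.support.filter (fun α => ∀ j, 1 ≤ α j), V.coeff α := by
  simp_rw [MvPolynomial.eval_eq', Finset.mul_sum]
  rw [Finset.sum_comm, Finset.sum_filter]
  refine Finset.sum_congr rfl fun α _ => ?_
  rw [← mul_boole, ← sum_neg_one_pow_mul_prod_indicator_pow, Finset.mul_sum]
  exact Finset.sum_congr rfl fun J _ => mul_left_comm _ _ _

theorem sum_indicator_smul_set {ι E : Type*} [Fintype ι] [DecidableEq ι] [AddCommGroup E] [Module ℝ E]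
    {P : ι → Set E} (hP : ∀ i, (P i).Nonempty) (J : Finset ι) :
    ∑ i, (if i ∈ J then (1 : ℝ) else 0) • P i = ∑ i ∈ J, P i := by
  rw [← Finset.sum_subset (Finset.subset_univ J)
    (f := fun i => (if i ∈ J then (1 : ℝ) else 0) • P i)]
  · exact Finset.sum_congr rfl fun i hi => by rw [if_pos hi, one_smul]
  · intro i _ hi
    rw [if_neg hi, Set.zero_smul_set (hP i)]

/-- **Steffens–Theobald.** If `P_1 + ⋯ + P_k` is `d`-dimensional, `M` is the mixed
Ehrhart polynomial and `V` is the (homogeneous, degree `d`) volume polynomial of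
`(P_1, …, P_k)`, then the leading coefficient of `M` is the sum of the coefficients
`v_α` of `V` over all `α ∈ ℤ_{≥1}^k` with `|α| = d`. -/
theorem mixed_ehrhart_leading_coeff_eq_sum_volume_coeffs
    {d k : ℕ} (P : Fin k → Set (Fin d → ℝ))
    (hP : ∀ i, IsLatticePolytope (P i))
    (hdim : polytopeDim (∑ i, P i) = d)
    (M : Polynomial ℝ) (hMdeg : M.natDegree ≤ d)
    (hM : ∀ n : ℕ, M.eval (n : ℝ) = (DMV (fun i => (n : ℝ) • P i) : ℝ))
    (V : MvPolynomial (Fin k) ℝ) (hVhom : V.IsHomogeneous d)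
    (hV : ∀ n : Fin k → ℝ, (∀ i, 0 ≤ n i) →
      MvPolynomial.eval n V = (MeasureTheory.volume (∑ i, n i • P i)).toReal) :
    M.coeff d
      = ∑ α ∈ V.support.filter (fun α => (∀ j, 1 ≤ α j) ∧ ∑ j, α j = d),
          V.coeff α := by
  have hvol : ∀ J : Finset (Fin k),
      MvPolynomial.eval (fun i => if i ∈ J then (1 : ℝ) else 0) V
        = (volume (∑ i ∈ J, P i)).toReal := by
    intro J
    rw [hV _ fun i => by split_ifs <;> norm_num,
      sum_indicator_smul_set (fun i => (hP i).nonempty) J]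
  have hlim : Tendsto (fun n : ℕ => M.eval (n : ℝ) / (n : ℝ) ^ d) atTop
      (nhds (∑ J : Finset (Fin k),
        (-1 : ℝ) ^ (k - J.card) * (volume (∑ i ∈ J, P i)).toReal)) := by
    have h := tendsto_finsetSum Finset.univ fun (J : Finset (Fin k)) _ =>
      (tendsto_latticePointCount_smul_div_pow
        (convex_sum (s := J) P fun i _ => (hP i).convex)
        (isCompact_finset_sum J fun i _ => (hP i).isCompact)).const_mul
          ((-1 : ℝ) ^ (k - J.card))
    refine h.congr fun n => ?_
    rw [hM n, DMV]
    push_cast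
    rw [Finset.sum_div]
    refine Finset.sum_congr rfl fun J _ => ?_
    rw [Finset.smul_sum, mul_div_assoc]
  rw [tendsto_nhds_unique (M.tendsto_eval_natCast_div_pow hMdeg) hlim]
  simp_rw [← hvol]
  rw [MvPolynomial.sum_neg_one_pow_mul_eval_indicator]
  refine Finset.sum_congr (Finset.filter_congr fun α hα => ?_) fun _ _ => rfl
  have hdeg : ∑ j, α j = d := by
    rw [← Finsupp.degree_eq_sum]
    by_contra hne
    exact MvPolynomial.mem_support_iff.1 hα (hVhom.coeff_eq_zero hne)
  simp [hdeg]
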